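/- arXiv:2303.10463 — 7 statements merged into one kernel-verified Lean document; each statement's English description precedes it below -/
import Mathlib

section
/- Let n ≥ 1 and let C be a pipe dream of size n (a subset of the staircase {(i,j) : i,j ≥ 1, i+j ≤ n}). Then C is pseudo-Yamanouchi if and only if C satisfies the TSSCPP inequalities; that is, writing y_{i,j} = 1 when (i,j) ∈ C and y_{i,j} = 0 otherwise, C is pseudo-Yamanouchi if and only if for all 1 ≤ i < j ≤ n−1 one has 1 + Σ_{k=1}^{i} y_{j−k,k} ≥ Σ_{k=1}^{i+1} y_{j−k+1,k}. -/
/-- `C` is a pipe dream of size `n`: a set of cross positions `(i,j)` in the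
staircase `{(i,j) : i ≥ 1, j ≥ 1, i + j ≤ n}`. -/
def IsPipeDream (n : ℕ) (C : Finset (ℕ × ℕ)) : Prop :=
  ∀ p ∈ C, 1 ≤ p.1 ∧ 1 ≤ p.2 ∧ p.1 + p.2 ≤ n

/-- The reading word of a pipe dream: scan rows `i = n-1, …, 1` from bottom to top,
within each row scan columns `j` in increasing order, and record `i + j - 1`
for each cross `(i,j) ∈ C`.  (Here row `r+1` for `r = n-2, …, 0` and column `c+1`,
recording `(r+1) + (c+1) - 1 = r + c + 1`.) -/
def readingWord (n : ℕ) (C : Finset (ℕ × ℕ)) : List ℕ :=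
  (List.range (n - 1)).reverse.flatMap fun r =>
    (List.range n).filterMap fun c =>
      if (r + 1, c + 1) ∈ C then some (r + c + 1) else none

/-- `C` is pseudo-Yamanouchi: for every prefix of the reading word and every
`1 ≤ j ≤ n - 2`, the number of occurrences of `j+1` is at most `1` plus the
number of occurrences of `j`. -/
def PseudoYamanouchi (n : ℕ) (C : Finset (ℕ × ℕ)) : Prop :=
  ∀ k j : ℕ, 1 ≤ j → j ≤ n - 2 →
    ((readingWord n C).take k).count (j + 1) ≤ 1 + ((readingWord n C).take k).count j

/-- `C` satisfies the TSSCPP inequalities: with `y` the 0-1 indicator of `C`,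
for all `1 ≤ i < j ≤ n-1`, `1 + Σ_{k=1}^{i} y_{j-k,k} ≥ Σ_{k=1}^{i+1} y_{j-k+1,k}`. -/
def SatisfiesTSSCPP (n : ℕ) (C : Finset (ℕ × ℕ)) : Prop :=
  ∀ i j : ℕ, 1 ≤ i → i < j → j ≤ n - 1 →
    (∑ k ∈ Finset.Icc 1 (i + 1), if (j - k + 1, k) ∈ C then (1 : ℕ) else 0) ≤
      1 + ∑ k ∈ Finset.Icc 1 i, if (j - k, k) ∈ C then (1 : ℕ) else 0

/-- The part of the reading word contributed by row `r + 1`. -/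
def rowWord (n : ℕ) (C : Finset (ℕ × ℕ)) (r : ℕ) : List ℕ :=
  (List.range n).filterMap fun c =>
    if (r + 1, c + 1) ∈ C then some (r + c + 1) else none

/-- The part of the reading word contributed by the rows `s + 1, …, n - 1`. -/
def lowerWord (n : ℕ) (C : Finset (ℕ × ℕ)) (s : ℕ) : List ℕ :=
  (List.range' s (n - 1 - s)).reverse.flatMap (rowWord n C)

theorem rowWord_pairwise (n : ℕ) (C : Finset (ℕ × ℕ)) (r : ℕ) :
    (rowWord n C r).Pairwise (· < ·) := by
  unfold rowWord
  rw [List.pairwise_filterMap]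
  refine List.pairwise_lt_range.imp ?_
  intro a b hab x hx y hy
  split_ifs at hx hy
  simp_all only [Option.some.injEq]
  omega

theorem mem_rowWord {n : ℕ} {C : Finset (ℕ × ℕ)} (hC : IsPipeDream n C) (r a : ℕ) :
    a ∈ rowWord n C r ↔ (r + 1, a - r) ∈ C := by
  simp only [rowWord, List.mem_filterMap, List.mem_range, Option.ite_none_right_eq_some,
    Option.some.injEq]
  constructor
  · rintro ⟨c, -, h, rfl⟩
    rwa [show r + c + 1 - r = c + 1 by omega]
  · intro h
    have := hC _ h
    simp only at this
    refine ⟨a - r - 1, by omega, ?_, by omega⟩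
    rwa [show a - r - 1 + 1 = a - r by omega]

theorem count_rowWord {n : ℕ} {C : Finset (ℕ × ℕ)} (hC : IsPipeDream n C) (r a : ℕ) :
    (rowWord n C r).count a = if (r + 1, a - r) ∈ C then 1 else 0 := by
  have hnd : (rowWord n C r).Nodup := (rowWord_pairwise n C r).imp fun h => h.ne
  rw [hnd.count]
  simp only [mem_rowWord hC]

theorem lowerWord_eq_append (n : ℕ) (C : Finset (ℕ × ℕ)) {s : ℕ} (hs : s < n - 1) :
    lowerWord n C s = lowerWord n C (s + 1) ++ rowWord n C s := by
  unfold lowerWord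
  rw [show n - 1 - s = (n - 1 - (s + 1)) + 1 by omega, List.range'_succ]
  simp

theorem lowerWord_isPrefix_readingWord (n : ℕ) (C : Finset (ℕ × ℕ)) {s : ℕ} (hs : s ≤ n - 1) :
    lowerWord n C s <+: readingWord n C := by
  refine ⟨(List.range s).reverse.flatMap (rowWord n C), ?_⟩
  change _ = (List.range (n - 1)).reverse.flatMap (rowWord n C)
  have h : List.range (n - 1) = List.range s ++ List.range' s (n - 1 - s) := by
    rw [← Nat.add_sub_of_le hs, List.range_add, Nat.add_sub_cancel_left, List.range'_eq_map_range]
  rw [h, List.reverse_append, List.flatMap_append]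
  rfl

/-- A prefix of the word read from rows `m, …, 1` is empty or ends inside a single row. -/
theorem prefix_flatMap_reverse_range {α : Type*} (f : ℕ → List α) (m : ℕ) (p : List α)
    (hp : p <+: (List.range m).reverse.flatMap f) :
    p = [] ∨ ∃ x < m, ∃ q, q <+: f x ∧
      p = (List.range' (x + 1) (m - (x + 1))).reverse.flatMap f ++ q := by
  induction m generalizing p with
  | zero => left; simpa using hp
  | succ m ih =>
    right
    rw [List.range_succ, List.reverse_append, List.reverse_singleton, List.singleton_append,
      List.flatMap_cons] at hp
    rcases List.prefix_or_prefix_of_prefix hp (List.prefix_append _ _) with hp' | ⟨p', rfl⟩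
    · exact ⟨m, by omega, p, hp', by simp⟩
    · rw [List.prefix_append_right_inj] at hp
      rcases ih p' hp with rfl | ⟨x, hx, q, hq, rfl⟩
      · exact ⟨m, by omega, f m, List.prefix_rfl, by simp⟩
      · refine ⟨x, by omega, q, hq, ?_⟩
        rw [show m + 1 - (x + 1) = (m - (x + 1)) + 1 by omega, List.range'_concat,
          show x + 1 + 1 * (m - (x + 1)) = m by omega]
        simp

theorem count_lowerWord {n : ℕ} {C : Finset (ℕ × ℕ)} (hC : IsPipeDream n C) {s : ℕ}
    (hs : s ≤ n - 1) (a : ℕ) :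
    (lowerWord n C s).count a =
      ∑ r ∈ Finset.Ico s (n - 1), if (r + 1, a - r) ∈ C then 1 else 0 := by
  induction hs using Nat.decreasingInduction with
  | self => simp [lowerWord]
  | of_succ s hs ih =>
    rw [lowerWord_eq_append n C hs, List.count_append, ih, count_rowWord hC,
      Finset.sum_eq_sum_Ico_succ_bot hs, add_comm]

theorem notMem_of_le {n : ℕ} {C : Finset (ℕ × ℕ)} (hC : IsPipeDream n C) {a r : ℕ}
    (h : a ≤ r) : (r + 1, a - r) ∉ C := by
  intro hm
  have := hC _ hm
  simp only at this
  omega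

/-- The number of letters `a` in the rows `s + 1, …, n - 1`, as an antidiagonal sum indexed by columns. -/
theorem count_lowerWord_eq_sum_Icc {n : ℕ} {C : Finset (ℕ × ℕ)} (hC : IsPipeDream n C)
    {s a : ℕ} (hs : s ≤ a) (ha : a ≤ n - 1) :
    (lowerWord n C s).count a =
      ∑ k ∈ Finset.Icc 1 (a - s), if (a - k + 1, k) ∈ C then 1 else 0 := by
  rw [count_lowerWord hC (hs.trans ha), ← Finset.sum_Ico_consecutive _ hs ha,
    Finset.sum_eq_zero (s := Finset.Ico a (n - 1)), add_zero]
  · refine Finset.sum_nbij' (fun r => a - r) (fun k => a - k) ?_ ?_ ?_ ?_ ?_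
    · intro r; simp only [Finset.mem_Ico, Finset.mem_Icc]; omega
    · intro r; simp only [Finset.mem_Ico, Finset.mem_Icc]; omega
    · intro r; simp only [Finset.mem_Ico]; omega
    · intro r; simp only [Finset.mem_Icc]; omega
    · intro r hr
      rw [Finset.mem_Ico] at hr
      rw [show a - (a - r) = r by omega]
  · intro r hr
    exact if_neg (notMem_of_le hC (Finset.mem_Ico.mp hr).1)

theorem count_lowerWord_eq_zero {n : ℕ} {C : Finset (ℕ × ℕ)} (hC : IsPipeDream n C) {s a : ℕ}
    (hs : s ≤ n - 1) (has : a ≤ s) : (lowerWord n C s).count a = 0 := by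
  rw [count_lowerWord hC hs]
  exact Finset.sum_eq_zero fun r hr =>
    if_neg (notMem_of_le hC (has.trans (Finset.mem_Ico.mp hr).1))

theorem satisfiesTSSCPP_iff_count_lowerWord {n : ℕ} {C : Finset (ℕ × ℕ)}
    (hC : IsPipeDream n C) :
    SatisfiesTSSCPP n C ↔ ∀ s a : ℕ, s < a → a + 1 ≤ n - 1 →
      (lowerWord n C s).count (a + 1) ≤ 1 + (lowerWord n C s).count a := by
  have key : ∀ s a : ℕ, s < a → a + 1 ≤ n - 1 →
      (((∑ k ∈ Finset.Icc 1 (a - s + 1), if (a + 1 - k + 1, k) ∈ C then (1 : ℕ) else 0) ≤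
        1 + ∑ k ∈ Finset.Icc 1 (a - s), if (a + 1 - k, k) ∈ C then (1 : ℕ) else 0) ↔
      (lowerWord n C s).count (a + 1) ≤ 1 + (lowerWord n C s).count a) := by
    intro s a hs ha
    rw [count_lowerWord_eq_sum_Icc hC (by omega) ha,
      count_lowerWord_eq_sum_Icc hC hs.le (by omega),
      show a + 1 - s = a - s + 1 by omega]
    rw [Finset.sum_congr (s₁ := Finset.Icc 1 (a - s)) rfl]
    intro k hk
    rw [Finset.mem_Icc] at hk
    rw [show a + 1 - k = a - k + 1 by omega]
  constructor
  · intro h s a hs ha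
    exact (key s a hs ha).1 (h (a - s) (a + 1) (by omega) (by omega) ha)
  · intro h i j hi hij hj
    have := (key (j - 1 - i) (j - 1) (by omega) (by omega)).2
      (h (j - 1 - i) (j - 1) (by omega) (by omega))
    rwa [show j - 1 - (j - 1 - i) = i by omega, show j - 1 + 1 = j by omega] at this

/-- A pipe dream `C` of size `n ≥ 1` is pseudo-Yamanouchi if and only if it
satisfies the TSSCPP inequalities. -/
theorem pseudoYamanouchi_iff_satisfiesTSSCPP (n : ℕ) (hn : 1 ≤ n)
    (C : Finset (ℕ × ℕ)) (hC : IsPipeDream n C) :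
    PseudoYamanouchi n C ↔ SatisfiesTSSCPP n C := by
  rw [satisfiesTSSCPP_iff_count_lowerWord hC]
  constructor
  · intro h s a hs ha
    have := h (lowerWord n C s).length a (by omega) (by omega)
    rwa [← List.prefix_iff_eq_take.mp (lowerWord_isPrefix_readingWord n C (by omega))] at this
  · intro h k a ha1 ha
    have hlower : ∀ s ≤ n - 1,
        (lowerWord n C s).count (a + 1) ≤ 1 + (lowerWord n C s).count a := by
      intro s hs
      rcases lt_or_ge s a with hsa | hsa
      · exact h s a hsa (by omega)
      · rcases hs.eq_or_lt with rfl | hs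
        · simp [lowerWord]
        · rw [lowerWord_eq_append n C hs, List.count_append, List.count_append,
            count_lowerWord_eq_zero hC hs (by omega), count_rowWord hC]
          split_ifs <;> omega
    rcases prefix_flatMap_reverse_range (rowWord n C) (n - 1) _
      ⟨_, List.take_append_drop k (readingWord n C)⟩ with hp | ⟨x, hx, q, ⟨t, ht⟩, hp⟩
    · simp [hp]
    · rw [hp]
      change (lowerWord n C (x + 1) ++ q).count (a + 1) ≤
        1 + (lowerWord n C (x + 1) ++ q).count a
      by_cases haq : a + 1 ∈ q
      · have hat : a ∉ t := by
          intro hat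
          have hpw := rowWord_pairwise n C x
          rw [← ht, List.pairwise_append] at hpw
          have := hpw.2.2 _ haq _ hat
          omega
        have hle := hlower x hx.le
        rw [lowerWord_eq_append n C hx, ← ht] at hle
        simp only [List.count_append, List.count_eq_zero_of_not_mem hat] at hle ⊢
        omega
      · have hle := hlower (x + 1) hx
        simp only [List.count_append, List.count_eq_zero_of_not_mem haq] at hle ⊢
        omega
end

section
/- Let π be a permutation of {1,…,n} and let c_i = #{j : j > i and π(j) < π(i)} be its Lehmer code. Then the bottom pipe dream of π, namely the pipe dream C = {(i,j) : 1 ≤ i ≤ n−1, 1 ≤ j ≤ c_i} with all crosses left-justified, is pseudo-Yamanouchi. -/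
theorem filterMap_range_ite_lt_eq_map_range (f : ℕ → ℕ) (d n : ℕ) :
    ((List.range n).filterMap fun c => if c < d then some (f c) else none) =
      (List.range (min n d)).map f := by
  induction n with
  | zero => simp
  | succ n ih =>
    rw [List.range_succ, List.filterMap_append, ih]
    by_cases h : n < d
    · rw [min_eq_left h.le, min_eq_left (Nat.succ_le_of_lt h), List.range_succ]
      simp [h]
    · rw [min_eq_right (by omega), min_eq_right (by omega)]
      simp [h]

theorem count_map_range_add (r m a : ℕ) :
    ((List.range m).map fun c => r + c + 1).count a =
      if r + 1 ≤ a ∧ a ≤ r + m then 1 else 0 := by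
  induction m with
  | zero =>
    rw [if_neg (by omega)]
    simp
  | succ m ih =>
    rw [List.range_succ, List.map_append, List.count_append, ih]
    simp only [List.map_cons, List.map_nil, List.count_singleton, beq_iff_eq]
    split_ifs <;> omega

/-- If in each word `w r` every prefix contains at most as many letters `j + 1` as `j`, up to
one extra letter when `r = j`, then prefixes of a concatenation of such words satisfy the
corresponding inequality. -/
theorem count_take_flatMap_le (w : ℕ → List ℕ) (j : ℕ) (L : List ℕ)
    (hw : ∀ r ∈ L, ∀ k, ((w r).take k).count (j + 1) ≤
      (if r = j then 1 else 0) + ((w r).take k).count j) (k : ℕ) :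
    ((L.flatMap w).take k).count (j + 1) ≤ L.count j + ((L.flatMap w).take k).count j := by
  induction L generalizing k with
  | nil => simp
  | cons a L ih =>
    have h₁ := hw a (by simp) k
    have h₂ := ih (fun r hr => hw r (List.mem_cons_of_mem a hr)) (k - (w a).length)
    rw [List.flatMap_cons, List.take_append, List.count_append, List.count_append,
      List.count_cons]
    simp only [beq_iff_eq]
    omega

/-- For a permutation `π` of `{1,…,n}` (formalized as a permutation of `ℕ` fixing
everything outside `{1,…,n}`) with Lehmer code `c_i = #{j > i : π j < π i}`, the
bottom pipe dream `{(i,j) : 1 ≤ i ≤ n-1, 1 ≤ j ≤ c_i}` (all crosses left-justified)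
is pseudo-Yamanouchi. -/
theorem bottom_pipeDream_pseudoYamanouchi (n : ℕ) (π : Equiv.Perm ℕ)
    (hπ : ∀ m : ℕ, m = 0 ∨ n < m → π m = m)
    (code : ℕ → ℕ)
    (hcode : ∀ i : ℕ, code i = ((Finset.Icc 1 n).filter fun j => i < j ∧ π j < π i).card)
    (C : Finset (ℕ × ℕ))
    (hC : ∀ p : ℕ × ℕ, p ∈ C ↔ 1 ≤ p.1 ∧ p.1 ≤ n - 1 ∧ 1 ≤ p.2 ∧ p.2 ≤ code p.1) :
    PseudoYamanouchi n C := by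
  intro k j _ _
  refine (count_take_flatMap_le _ j _ (fun r hr k => ?_) k).trans
    (Nat.add_le_add_right (List.nodup_iff_count_le_one.mp
      (List.nodup_reverse.mpr List.nodup_range) j) _)
  have hr' : r < n - 1 := by simpa using hr
  have hmem : ∀ c, (r + 1, c + 1) ∈ C ↔ c < code (r + 1) := fun c => by
    rw [hC]
    dsimp only
    omega
  simp only [hmem]
  rw [filterMap_range_ite_lt_eq_map_range (fun c => r + c + 1), ← List.map_take,
    List.take_range, count_map_range_add, count_map_range_add]
  split_ifs <;> omega
end

section
/- Let π be a permutation of {1,…,n} that avoids the pattern 2143. Then the essential boxes of π run from northeast to southwest: there do not exist (i₁,j₁), (i₂,j₂) ∈ ess(π) with i₁ < i₂ and j₁ < j₂. -/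
/-- The Rothe diagram of a permutation `π` of `{1,…,n}` (formalized as a
permutation of `ℕ` fixing everything outside `{1,…,n}`):
`D(π) = {(i,j) ∈ {1,…,n}² : j < π(i) and i < π⁻¹(j)}`. -/
def RotheDiagram (n : ℕ) (π : Equiv.Perm ℕ) : Set (ℕ × ℕ) :=
  {p : ℕ × ℕ | 1 ≤ p.1 ∧ p.1 ≤ n ∧ 1 ≤ p.2 ∧ p.2 ≤ n ∧ p.2 < π p.1 ∧ p.1 < π.symm p.2}

/-- The essential boxes of `π`: cells `(i,j)` of the Rothe diagram such that
neither `(i+1,j)` nor `(i,j+1)` lies in the Rothe diagram. -/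
def EssentialBoxes (n : ℕ) (π : Equiv.Perm ℕ) : Set (ℕ × ℕ) :=
  {p : ℕ × ℕ | p ∈ RotheDiagram n π ∧ (p.1 + 1, p.2) ∉ RotheDiagram n π ∧
    (p.1, p.2 + 1) ∉ RotheDiagram n π}

/-- Adjacency of cells of the Rothe diagram: two cells of `D(π)` are adjacent
if they agree in one coordinate and differ by exactly `1` in the other. -/
def RotheAdj (n : ℕ) (π : Equiv.Perm ℕ) (p q : ℕ × ℕ) : Prop :=
  p ∈ RotheDiagram n π ∧ q ∈ RotheDiagram n π ∧
    ((p.1 = q.1 ∧ (p.2 + 1 = q.2 ∨ q.2 + 1 = p.2)) ∨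
      (p.2 = q.2 ∧ (p.1 + 1 = q.1 ∨ q.1 + 1 = p.1)))

/-- `B` is a connected component of the Rothe diagram of `π`: the set of cells
connected to some cell `p` of `D(π)` by the reflexive-transitive closure of
adjacency. -/
def IsRotheComponent (n : ℕ) (π : Equiv.Perm ℕ) (B : Set (ℕ × ℕ)) : Prop :=
  ∃ p ∈ RotheDiagram n π, B = {q | Relation.ReflTransGen (RotheAdj n π) p q}

/-- The dominant region of `D(π)`: the connected component of the cell `(1,1)`
(empty if `(1,1) ∉ D(π)`). -/
def DominantRegion (n : ℕ) (π : Equiv.Perm ℕ) : Set (ℕ × ℕ) :=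
  {q | (1, 1) ∈ RotheDiagram n π ∧ Relation.ReflTransGen (RotheAdj n π) (1, 1) q}

/-- `π` avoids the pattern 1432: there are no `a < b < c < d` in `{1,…,n}` with
`π a < π d < π c < π b`. -/
def Avoids1432 (n : ℕ) (π : Equiv.Perm ℕ) : Prop :=
  ¬ ∃ a b c d : ℕ, 1 ≤ a ∧ a < b ∧ b < c ∧ c < d ∧ d ≤ n ∧
      π a < π d ∧ π d < π c ∧ π c < π b

/-- `π` avoids the pattern 2143: there are no `a < b < c < d` in `{1,…,n}` with
`π b < π a < π d < π c`. -/
def Avoids2143 (n : ℕ) (π : Equiv.Perm ℕ) : Prop :=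
  ¬ ∃ a b c d : ℕ, 1 ≤ a ∧ a < b ∧ b < c ∧ c < d ∧ d ≤ n ∧
      π b < π a ∧ π a < π d ∧ π d < π c

/-- `π` is Grassmannian: it has at most one descent, i.e. at most one index `i`
in `{1,…,n}` with `π (i+1) < π i`. -/
def IsGrassmannian (n : ℕ) (π : Equiv.Perm ℕ) : Prop :=
  ((Finset.Icc 1 n).filter fun i => π (i + 1) < π i).card ≤ 1

/-- If `π` avoids 2143, its essential boxes run northeast to southwest: there do
not exist essential boxes `(i₁,j₁)`, `(i₂,j₂)` with `i₁ < i₂` and `j₁ < j₂`. -/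
theorem essentialBoxes_NE_SW_of_avoids2143 (n : ℕ) (π : Equiv.Perm ℕ)
    (hπ : ∀ m : ℕ, m = 0 ∨ n < m → π m = m)
    (hav : Avoids2143 n π) :
    ¬ ∃ i₁ j₁ i₂ j₂ : ℕ, (i₁, j₁) ∈ EssentialBoxes n π ∧ (i₂, j₂) ∈ EssentialBoxes n π ∧
        i₁ < i₂ ∧ j₁ < j₂ := by
  rintro ⟨i₁, j₁, i₂, j₂, ⟨h₁, hdown, hright⟩, ⟨h₂, -, -⟩, hi, hj⟩
  simp only [RotheDiagram, Set.mem_ofPred_eq] at h₁ h₂ hdown hright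
  have hb : π (i₁ + 1) ≤ j₁ := by
    by_contra! h
    have hne : π.symm j₁ ≠ i₁ + 1 := by
      intro e
      have := (Equiv.symm_apply_eq π).1 e
      omega
    exact hdown (by omega)
  have ha : π.symm (j₁ + 1) ≤ i₁ := by
    by_contra! h
    have hne : π i₁ ≠ j₁ + 1 := by
      intro e
      have := (Equiv.symm_apply_eq π).2 e.symm
      omega
    exact hright (by omega)
  have hπa : π (π.symm (j₁ + 1)) = j₁ + 1 := π.apply_symm_apply _
  have hπd : π (π.symm j₂) = j₂ := π.apply_symm_apply _
  have ha_pos : 1 ≤ π.symm (j₁ + 1) := by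
    by_contra! h
    have := hπ (π.symm (j₁ + 1)) (by omega)
    omega
  have hd_le : π.symm j₂ ≤ n := by
    by_contra! h
    have := hπ (π.symm j₂) (Or.inr h)
    omega
  have hbc : i₁ + 1 ≠ i₂ := by
    rintro rfl
    omega
  have had : j₁ + 1 ≠ j₂ := by
    rintro rfl
    omega
  exact hav ⟨π.symm (j₁ + 1), i₁ + 1, i₂, π.symm j₂, by omega⟩
end

section
/- Let π be a permutation of {1,…,n} that avoids the pattern 1432. Then every connected component of the Rothe diagram D(π) other than the dominant region is a rectangle: if B is a connected component of D(π) not containing the cell (1,1), then there exist r₁ ≤ r₂ and c₁ ≤ c₂ with B = {(i,j) : r₁ ≤ i ≤ r₂ and c₁ ≤ j ≤ c₂}. -/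
/-- The square condition: three cells of a `2 × 2` block of `S` force the fourth. -/
def SquareClosed (S : ℕ → ℕ → Prop) : Prop :=
  ∀ x x' y y', (x + 1 = x' ∨ x' + 1 = x) → (y + 1 = y' ∨ y' + 1 = y) →
    S x y → S x' y → S x y' → S x' y'

/-- Every cell of the rectangle with opposite corners `(a, b)` and `(x, y)` lies in `S`. -/
def ContainsHull (S : ℕ → ℕ → Prop) (a b x y : ℕ) : Prop :=
  ∀ u v, min a x ≤ u → u ≤ max a x → min b y ≤ v → v ≤ max b y → S u v

theorem SquareClosed.flip {S : ℕ → ℕ → Prop} (h : SquareClosed S) :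
    SquareClosed fun x y => S y x :=
  fun x x' y y' hx hy h₁ h₂ h₃ => h y y' x x' hy hx h₁ h₃ h₂

theorem ContainsHull.flip {S : ℕ → ℕ → Prop} {a b x y : ℕ} (h : ContainsHull S a b x y) :
    ContainsHull (fun x y => S y x) b a y x :=
  fun u v h₁ h₂ h₃ h₄ => h v u h₃ h₄ h₁ h₂

/-- A cell next to a full row segment fills the neighbouring row segment. -/
theorem SquareClosed.fill_row {S : ℕ → ℕ → Prop} (h : SquareClosed S) {x x' y : ℕ}
    (hx : x + 1 = x' ∨ x' + 1 = x) (hy : S x' y) (k : ℕ) :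
    ((∀ v, y ≤ v → v ≤ y + k → S x v) → S x' (y + k)) ∧
      (k ≤ y → (∀ v, y - k ≤ v → v ≤ y → S x v) → S x' (y - k)) := by
  induction k with
  | zero => exact ⟨fun _ => hy, fun _ _ => hy⟩
  | succ k ih =>
    refine ⟨fun hr => ?_, fun hk hr => ?_⟩
    · exact h x x' (y + k) (y + (k + 1)) hx (Or.inl rfl) (hr _ (by omega) (by omega))
        (ih.1 fun v h₁ h₂ => hr v h₁ (by omega)) (hr _ (by omega) (by omega))
    · exact h x x' (y - k) (y - (k + 1)) hx (Or.inr (by omega)) (hr _ (by omega) (by omega))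
        (ih.2 (by omega) fun v h₁ h₂ => hr v (by omega) h₂) (hr _ (by omega) (by omega))

theorem SquareClosed.containsHull_step {S : ℕ → ℕ → Prop} (h : SquareClosed S)
    {a b x x' y : ℕ} (hx : x + 1 = x' ∨ x' + 1 = x) (hS : S x' y)
    (hull : ContainsHull S a b x y) : ContainsHull S a b x' y := by
  intro u v h₁ h₂ h₃ h₄
  by_cases hu : min a x ≤ u ∧ u ≤ max a x
  · exact hull u v hu.1 hu.2 h₃ h₄
  obtain rfl : u = x' := by omega
  rcases le_total y v with hv | hv
  · have := (h.fill_row hx hS (v - y)).1 fun w hw hw' =>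
      hull x w (by omega) (by omega) (by omega) (by omega)
    rwa [show y + (v - y) = v by omega] at this
  · have := (h.fill_row hx hS (y - v)).2 (by omega) fun w hw hw' =>
      hull x w (by omega) (by omega) (by omega) (by omega)
    rwa [show y - (y - v) = v by omega] at this

/-- A bounded nonempty set containing the rectangle spanned by any two of its cells is
a rectangle. -/
theorem eq_rectangle_of_containsHull {B : Set (ℕ × ℕ)} {n : ℕ} (hne : B.Nonempty)
    (hn : ∀ q ∈ B, q.1 ≤ n ∧ q.2 ≤ n)
    (hull : ∀ p ∈ B, ∀ q ∈ B, ContainsHull (fun x y => (x, y) ∈ B) p.1 p.2 q.1 q.2) :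
    ∃ r₁ r₂ c₁ c₂ : ℕ, r₁ ≤ r₂ ∧ c₁ ≤ c₂ ∧
      B = {p : ℕ × ℕ | r₁ ≤ p.1 ∧ p.1 ≤ r₂ ∧ c₁ ≤ p.2 ∧ p.2 ≤ c₂} := by
  have hfin : B.Finite := ((Set.finite_Iic n).prod (Set.finite_Iic n)).subset fun q hq => hn q hq
  obtain ⟨t, ht, ht'⟩ := hfin.exists_minimalFor Prod.fst B hne
  obtain ⟨b, hb, hb'⟩ := hfin.exists_maximalFor Prod.fst B hne
  obtain ⟨l, hl, hl'⟩ := hfin.exists_minimalFor Prod.snd B hne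
  obtain ⟨r, hr, hr'⟩ := hfin.exists_maximalFor Prod.snd B hne
  have top : ∀ q ∈ B, t.1 ≤ q.1 := fun q hq => (le_total t.1 q.1).elim id (ht' hq)
  have bot : ∀ q ∈ B, q.1 ≤ b.1 := fun q hq => (le_total b.1 q.1).elim (hb' hq) id
  have left : ∀ q ∈ B, l.2 ≤ q.2 := fun q hq => (le_total l.2 q.2).elim id (hl' hq)
  have right : ∀ q ∈ B, q.2 ≤ r.2 := fun q hq => (le_total r.2 q.2).elim (hr' hq) id
  have h₁ : (t.1, l.2) ∈ B := hull t ht l hl _ _ (by simp) (by simp) (by simp) (by simp)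
  have h₂ : (b.1, r.2) ∈ B := hull b hb r hr _ _ (by simp) (by simp) (by simp) (by simp)
  refine ⟨t.1, b.1, l.2, r.2, top b hb, left r hr, Set.ext fun q => ⟨fun hq => ?_, ?_⟩⟩
  · exact ⟨top q hq, bot q hq, left q hq, right q hq⟩
  · rintro ⟨g₁, g₂, g₃, g₄⟩
    exact hull _ h₁ _ h₂ q.1 q.2 (min_le_of_left_le g₁) (le_max_of_le_right g₂)
      (min_le_of_left_le g₃) (le_max_of_le_right g₄)

theorem RotheAdj.symm {n : ℕ} {π : Equiv.Perm ℕ} {p q : ℕ × ℕ} (h : RotheAdj n π p q) :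
    RotheAdj n π q p := by
  obtain ⟨hp, hq, h⟩ := h
  exact ⟨hq, hp, by omega⟩

theorem RotheAdj.reflTransGen_symm {n : ℕ} {π : Equiv.Perm ℕ} {p q : ℕ × ℕ}
    (h : Relation.ReflTransGen (RotheAdj n π) p q) : Relation.ReflTransGen (RotheAdj n π) q p := by
  induction h with
  | refl => exact .refl
  | tail _ h ih => exact .head h.symm ih

theorem RotheAdj.containsHull {n : ℕ} {π : Equiv.Perm ℕ} {S : ℕ → ℕ → Prop}
    (hS : SquareClosed S) {p q q' : ℕ × ℕ} (h : RotheAdj n π q q') (hq' : S q'.1 q'.2)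
    (hull : ContainsHull S p.1 p.2 q.1 q.2) : ContainsHull S p.1 p.2 q'.1 q'.2 := by
  obtain ⟨x, y⟩ := q
  obtain ⟨x', y'⟩ := q'
  obtain ⟨-, -, ⟨rfl, hy⟩ | ⟨rfl, hx⟩⟩ := h
  · exact (hS.flip.containsHull_step hy hq' hull.flip).flip
  · exact hS.containsHull_step hx hq' hull

/-- A cell of the Rothe diagram with no dot strictly to its northwest is connected to `(1, 1)`. -/
theorem reflTransGen_one_one_of_no_dot {n : ℕ} {π : Equiv.Perm ℕ} (h₀ : π 0 = 0) {i j : ℕ}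
    (hij : (i, j) ∈ RotheDiagram n π) (hdot : ∀ a, 1 ≤ a → a < i → j ≤ π a) :
    Relation.ReflTransGen (RotheAdj n π) (i, j) (1, 1) := by
  obtain ⟨hi, hin, hj, hjn, hπi, hπj⟩ := hij
  dsimp only at *
  have mem : ∀ a b, 1 ≤ a → a ≤ i → 1 ≤ b → b ≤ j → (a, b) ∈ RotheDiagram n π := by
    intro a b ha hai hb hbj
    have large : ∀ c, 1 ≤ c → c ≤ i → j < π c := by
      intro c hc hci
      rcases hci.lt_or_eq with hlt | rfl
      · refine (hdot c hc hlt).lt_of_ne fun h => ?_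
        rw [h, π.symm_apply_apply] at hπj
        omega
      · exact hπi
    refine ⟨ha, by omega, hb, by omega, by have := large a ha hai; dsimp only; omega, ?_⟩
    by_contra! hle
    dsimp only at hle
    have hpos : 1 ≤ π.symm b := by
      rcases Nat.eq_zero_or_pos (π.symm b) with h | h
      · rw [Equiv.symm_apply_eq, h₀] at h
        omega
      · exact h
    have := large _ hpos (hle.trans hai)
    rw [π.apply_symm_apply] at this
    omega
  have col : ∀ a, 1 ≤ a → a ≤ i → Relation.ReflTransGen (RotheAdj n π) (a, j) (1, j) := by
    intro a ha
    induction a, ha using Nat.le_induction with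
    | base => exact fun _ => .refl
    | succ a ha ih =>
      intro hai
      exact .head ⟨mem _ _ (by omega) hai hj le_rfl, mem _ _ ha (by omega) hj le_rfl,
        Or.inr ⟨rfl, Or.inr rfl⟩⟩ (ih (by omega))
  have row : ∀ b, 1 ≤ b → b ≤ j → Relation.ReflTransGen (RotheAdj n π) (1, b) (1, 1) := by
    intro b hb
    induction b, hb using Nat.le_induction with
    | base => exact fun _ => .refl
    | succ b hb ih =>
      intro hbj
      exact .head ⟨mem _ _ le_rfl hi (by omega) hbj, mem _ _ le_rfl hi hb (by omega),
        Or.inl ⟨rfl, Or.inr rfl⟩⟩ (ih (by omega))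
  exact (col i hi le_rfl).trans (row j hj le_rfl)

/-- For a 1432-avoiding permutation, three cells of a `2 × 2` block of the diagram force the
fourth, provided that each of the three has a dot strictly to its northwest. -/
theorem Avoids1432.mem_of_square {n : ℕ} {π : Equiv.Perm ℕ}
    (hπ : ∀ m : ℕ, m = 0 ∨ n < m → π m = m) (hav : Avoids1432 n π) {x x' y y' : ℕ}
    (hx : x + 1 = x' ∨ x' + 1 = x) (hy : y + 1 = y' ∨ y' + 1 = y)
    (h₁ : (x, y) ∈ RotheDiagram n π) (h₂ : (x', y) ∈ RotheDiagram n π)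
    (h₃ : (x, y') ∈ RotheDiagram n π) (hdot : ∃ a, 1 ≤ a ∧ a < x ∧ π a < y) :
    (x', y') ∈ RotheDiagram n π := by
  obtain ⟨a1, a2, a3, a4, a5, a6⟩ := h₁
  obtain ⟨b1, b2, b3, b4, b5, b6⟩ := h₂
  obtain ⟨c1, c2, c3, c4, c5, c6⟩ := h₃
  dsimp only at *
  have hne : π x' ≠ y' := by
    intro heq
    have hsymm : π.symm y' = x' := by rw [← heq, π.symm_apply_apply]
    obtain ⟨a, ha, hax, hay⟩ := hdot
    have hd : π.symm y ≤ n := by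
      by_contra! hlt
      have := hπ _ (Or.inr hlt)
      rw [π.apply_symm_apply] at this
      omega
    have hval := π.apply_symm_apply y
    exact hav ⟨a, x, x', π.symm y, ha, hax, by omega, b6, hd, by omega, by omega, by omega⟩
  have hne' : π.symm y' ≠ x' := fun h => hne (by rw [← h, π.apply_symm_apply])
  exact ⟨b1, b2, c3, c4, by dsimp only; omega, by dsimp only; omega⟩

/-- If `π` avoids 1432, every connected component of the Rothe diagram `D(π)`
other than the dominant region (i.e. not containing `(1,1)`) is a rectangle. -/
theorem component_rectangle_of_avoids1432 (n : ℕ) (π : Equiv.Perm ℕ)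
    (hπ : ∀ m : ℕ, m = 0 ∨ n < m → π m = m)
    (hav : Avoids1432 n π)
    (B : Set (ℕ × ℕ)) (hB : IsRotheComponent n π B) (hdom : (1, 1) ∉ B) :
    ∃ r₁ r₂ c₁ c₂ : ℕ, r₁ ≤ r₂ ∧ c₁ ≤ c₂ ∧
      B = {p : ℕ × ℕ | r₁ ≤ p.1 ∧ p.1 ≤ r₂ ∧ c₁ ≤ p.2 ∧ p.2 ≤ c₂} := by
  obtain ⟨p₀, hp₀, rfl⟩ := hB
  set B := {q | Relation.ReflTransGen (RotheAdj n π) p₀ q}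
  have hBD : ∀ q ∈ B, q ∈ RotheDiagram n π := by
    intro q hq
    rcases Relation.ReflTransGen.cases_tail hq with rfl | ⟨_, -, h⟩
    exacts [hp₀, h.2.1]
  have hsq : SquareClosed fun x y => (x, y) ∈ B := by
    intro x x' y y' hx hy h₁ h₂ h₃
    have hdot : ∃ a, 1 ≤ a ∧ a < x ∧ π a < y := by
      by_contra! hno
      exact hdom (Relation.ReflTransGen.trans h₁
        (reflTransGen_one_one_of_no_dot (hπ 0 (Or.inl rfl)) (hBD _ h₁) hno))
    have hmem := hav.mem_of_square hπ hx hy (hBD _ h₁) (hBD _ h₂) (hBD _ h₃) hdot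
    exact Relation.ReflTransGen.tail h₂ ⟨hBD _ h₂, hmem, Or.inl ⟨rfl, hy⟩⟩
  refine eq_rectangle_of_containsHull (n := n) ⟨p₀, .refl⟩
    (fun q hq => ⟨(hBD q hq).2.1, (hBD q hq).2.2.2.1⟩) fun p hp q hq => ?_
  have hpq : Relation.ReflTransGen (RotheAdj n π) p q :=
    (RotheAdj.reflTransGen_symm hp).trans hq
  clear hq
  induction hpq with
  | refl =>
    intro u v h₁ h₂ h₃ h₄
    obtain rfl : u = p.1 := by omega
    obtain rfl : v = p.2 := by omega
    exact hp
  | tail hpb hbc ih => exact hbc.containsHull hsq ((Relation.ReflTransGen.trans hp hpb).tail hbc) ih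
end

section
/- Let π be a permutation of {1,…,n} that avoids both patterns 1432 and 2143. If (i,j₁), (i,j₂) ∈ ess(π) with j₁ < j₂ and (i,j₁) does not lie in the dominant region of D(π), then (i′,j₁) ∉ ess(π) for every i′ > i. Similarly, if (i₁,j), (i₂,j) ∈ ess(π) with i₁ < i₂ and (i₁,j) does not lie in the dominant region, then (i₁,j′) ∉ ess(π) for every j′ > j. -/
/-- If all cells weakly north-west of `(i, j)` lie in the Rothe diagram, then so does `(i, j)`, and
it belongs to the dominant region. -/
theorem mem_dominantRegion_of_forall_mem {n : ℕ} {π : Equiv.Perm ℕ} {i j : ℕ} (hi : 1 ≤ i)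
    (hj : 1 ≤ j) (h : ∀ a b, 1 ≤ a → a ≤ i → 1 ≤ b → b ≤ j → (a, b) ∈ RotheDiagram n π) :
    (i, j) ∈ DominantRegion n π := by
  refine ⟨h 1 1 le_rfl hi le_rfl hj, ?_⟩
  have column : ∀ a, 1 ≤ a → a ≤ i → Relation.ReflTransGen (RotheAdj n π) (1, 1) (a, 1) := by
    intro a ha
    induction a, ha using Nat.le_induction with
    | base => exact fun _ => .refl
    | succ a ha ih =>
      exact fun hai => (ih (by omega)).tail
        ⟨h a 1 ha (by omega) le_rfl hj, h (a + 1) 1 (by omega) hai le_rfl hj,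
          .inr ⟨rfl, .inl rfl⟩⟩
  have row : ∀ b, 1 ≤ b → b ≤ j → Relation.ReflTransGen (RotheAdj n π) (1, 1) (i, b) := by
    intro b hb
    induction b, hb using Nat.le_induction with
    | base => exact fun _ => column i hi le_rfl
    | succ b hb ih =>
      exact fun hbj => (ih (by omega)).tail
        ⟨h i b hi le_rfl hb (by omega), h i (b + 1) hi le_rfl (by omega) hbj,
          .inl ⟨rfl, .inl rfl⟩⟩
  exact row j hj le_rfl

/-- A permutation sending `0` to `0` has a dot weakly north-west of every cell of its Rothe diagram
outside the dominant region. -/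
theorem exists_apply_le_of_notMem_dominantRegion {n : ℕ} {π : Equiv.Perm ℕ} (h0 : π 0 = 0)
    {i j : ℕ} (hD : (i, j) ∈ RotheDiagram n π) (h : (i, j) ∉ DominantRegion n π) :
    ∃ a, 1 ≤ a ∧ a ≤ i ∧ π a ≤ j := by
  obtain ⟨hi, hin, hj, hjn, -, -⟩ := hD
  by_contra! hno
  refine h (mem_dominantRegion_of_forall_mem hi hj fun a b ha hai hb hbj =>
    ⟨ha, hai.trans hin, hb, hbj.trans hjn, hbj.trans_lt (hno a ha hai), ?_⟩)
  by_contra! hle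
  have hb' : π (π.symm b) = b := π.apply_symm_apply b
  have hpos : 1 ≤ π.symm b := by
    by_contra! hlt
    rw [Nat.lt_one_iff.mp hlt, h0] at hb'
    omega
  have := hno _ hpos (hle.trans hai)
  omega

/-- For `π` avoiding 1432 and 2143, an essential box outside the dominant region cannot have
essential boxes both to its right in its row and below it in its column. -/
theorem false_of_essentialBoxes_hook {n : ℕ} {π : Equiv.Perm ℕ}
    (hπ : ∀ m : ℕ, m = 0 ∨ n < m → π m = m) (hav1 : Avoids1432 n π) (hav2 : Avoids2143 n π)
    {i j i' j' : ℕ} (hij : (i, j) ∈ EssentialBoxes n π) (hr : (i, j') ∈ RotheDiagram n π)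
    (hjj' : j < j') (hb : (i', j) ∈ RotheDiagram n π) (hii' : i < i')
    (hdom : (i, j) ∉ DominantRegion n π) : False := by
  obtain ⟨a, ha, hai, haj⟩ := exists_apply_le_of_notMem_dominantRegion (hπ 0 (.inl rfl)) hij.1 hdom
  have symm_le : ∀ m, m ≤ n → π.symm m ≤ n := by
    intro m hm
    by_contra! hlt
    have := hπ _ (.inr hlt)
    rw [π.apply_symm_apply] at this
    omega
  simp only [EssentialBoxes, RotheDiagram, Set.mem_ofPred_eq] at hij hr hb
  obtain ⟨⟨hi, hin, hj, hjn, hji, hij⟩, hdown, hright⟩ := hij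
  have eq_symm : ∀ x y, π x = y → x = π.symm y := fun x y h => by simp [← h]
  have hp : π (π.symm j) = j := π.apply_symm_apply j
  have hq : π (π.symm j') = j' := π.apply_symm_apply j'
  have hd : π (π.symm (j + 1)) = j + 1 := π.apply_symm_apply (j + 1)
  have hpn := symm_le j hjn
  have hqn := symm_le j' hr.2.2.2.1
  have hai' : a < i := by
    rcases hai.lt_or_eq with h | rfl <;> omega
  have haj' : π a < j := by
    rcases haj.lt_or_eq with h | h
    · exact h
    · have := eq_symm a j h
      omega
  have hnext : π (i + 1) < j := by
    have hne : π (i + 1) ≠ j := fun h => by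
      have := eq_symm _ _ h
      omega
    omega
  have hdi : π.symm (j + 1) < i := by
    have hne : π.symm (j + 1) ≠ i := fun h => by
      rw [h] at hd
      omega
    omega
  have hdpos : 1 ≤ π.symm (j + 1) := by
    by_contra! hlt
    rw [Nat.lt_one_iff.mp hlt, hπ 0 (.inl rfl)] at hd
    omega
  have hi' : i + 1 < i' := by
    have hne : i + 1 ≠ i' := by
      rintro rfl
      omega
    omega
  have hj' : j + 1 < j' := by
    have hne : j + 1 ≠ j' := by
      rintro rfl
      omega
    omega
  have inj : ∀ x y, x ≠ y → π x ≠ π y := fun x y => π.injective.ne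
  have hii : π i < π i' := by
    by_contra! hle
    have := inj i i' (by omega)
    exact hav1 ⟨a, i, i', π.symm j, ha, hai', hii', by omega, hpn, by omega, by omega, by omega⟩
  have hpq : π.symm j < π.symm j' := by
    by_contra! hle
    have := π.symm.injective.ne hjj'.ne
    exact hav1 ⟨a, i, π.symm j', π.symm j, ha, hai', by omega, by omega, hpn, by omega, by omega,
      by omega⟩
  exact hav2 ⟨π.symm (j + 1), i + 1, i', π.symm j', hdpos, by omega, hi', by omega, hqn, by omega,
    by omega, by omega⟩

/-- If `π` avoids both 1432 and 2143: whenever `(i,j₁)` and `(i,j₂)` are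
essential boxes with `j₁ < j₂` and `(i,j₁)` is not in the dominant region, then
no `(i',j₁)` with `i' > i` is an essential box; and symmetrically, whenever
`(i₁,j)` and `(i₂,j)` are essential boxes with `i₁ < i₂` and `(i₁,j)` is not in
the dominant region, then no `(i₁,j')` with `j' > j` is an essential box. -/
theorem essentialBoxes_exclusion_of_avoids1432_2143 (n : ℕ) (π : Equiv.Perm ℕ)
    (hπ : ∀ m : ℕ, m = 0 ∨ n < m → π m = m)
    (hav1 : Avoids1432 n π) (hav2 : Avoids2143 n π) :
    (∀ i j₁ j₂ : ℕ, (i, j₁) ∈ EssentialBoxes n π → (i, j₂) ∈ EssentialBoxes n π →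
      j₁ < j₂ → (i, j₁) ∉ DominantRegion n π →
      ∀ i' : ℕ, i < i' → (i', j₁) ∉ EssentialBoxes n π) ∧
    (∀ i₁ i₂ j : ℕ, (i₁, j) ∈ EssentialBoxes n π → (i₂, j) ∈ EssentialBoxes n π →
      i₁ < i₂ → (i₁, j) ∉ DominantRegion n π →
      ∀ j' : ℕ, j < j' → (i₁, j') ∉ EssentialBoxes n π) := by
  exact ⟨fun i j₁ j₂ h₁ h₂ hj hdom i' hi h' =>
      false_of_essentialBoxes_hook hπ hav1 hav2 h₁ h₂.1 hj h'.1 hi hdom,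
    fun i₁ i₂ j h₁ h₂ hi hdom j' hj h' =>
      false_of_essentialBoxes_hook hπ hav1 hav2 h₁ h'.1 hj h₂.1 hi hdom⟩
end

section
/- Let π be a Grassmannian permutation of {1,…,n} (a permutation with at most one descent). Then every connected component of the Rothe diagram D(π) is a rectangle: for each connected component B of D(π) there exist r₁ ≤ r₂ and c₁ ≤ c₂ with B = {(i,j) : r₁ ≤ i ≤ r₂ and c₁ ≤ j ≤ c₂}. -/
/-- A Grassmannian permutation increases at every index other than one. -/
theorem IsGrassmannian.exists_forall_lt_succ {n : ℕ} {π : Equiv.Perm ℕ}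
    (hπ : ∀ m : ℕ, m = 0 ∨ n < m → π m = m) (hG : IsGrassmannian n π) :
    ∃ k, ∀ i, i ≠ k → π i < π (i + 1) := by
  have hmem : ∀ i, π (i + 1) < π i →
      i ∈ (Finset.Icc 1 n).filter fun i => π (i + 1) < π i := by
    intro i hi
    have h0 := hπ 0 (Or.inl rfl)
    have h1 : i ≠ 0 := by rintro rfl; omega
    have h2 : i ≤ n := by
      by_contra h
      have := hπ i (by omega)
      have := hπ (i + 1) (by omega)
      omega
    simp only [Finset.mem_filter, Finset.mem_Icc]
    omega
  have hne : ∀ i, π i ≠ π (i + 1) := fun i h => by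
    have := π.injective h
    omega
  by_cases hd : ∃ k, π (k + 1) < π k
  · obtain ⟨k, hk⟩ := hd
    refine ⟨k, fun i hik => ?_⟩
    by_contra h
    have := hne i
    exact hik (Finset.card_le_one.mp hG i (hmem i (by omega)) k (hmem k hk))
  · push Not at hd
    exact ⟨0, fun i _ => lt_of_le_of_ne (hd i) (hne i)⟩

theorem apply_lt_apply_of_forall_lt_succ {f : ℕ → ℕ} {a b : ℕ} (hab : a < b)
    (h : ∀ i, a ≤ i → i < b → f i < f (i + 1)) : f a < f b := by
  induction b, hab using Nat.le_induction with
  | base => exact h a le_rfl (Nat.lt_succ_self a)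
  | succ b hb ih =>
    exact (ih fun i hi hib => h i hi (by omega)).trans (h b (by omega) (by omega))

/-- The Rothe diagram of a permutation whose only possible descent is at `k`. -/
theorem mem_rotheDiagram_iff {n k : ℕ} {π : Equiv.Perm ℕ}
    (hπ : ∀ m : ℕ, m = 0 ∨ n < m → π m = m) (hk : ∀ i, i ≠ k → π i < π (i + 1))
    (i j : ℕ) : (i, j) ∈ RotheDiagram n π ↔ i ≤ k ∧ k < π.symm j ∧ j < π i := by
  have hsymm : ∀ m : ℕ, m = 0 ∨ n < m → π.symm m = m := fun m hm => by
    rw [Equiv.symm_apply_eq, hπ m hm]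
  constructor
  · rintro ⟨-, -, -, -, hj, hi⟩
    dsimp only at hj hi
    have hnot : ¬ π i < π (π.symm j) := by
      rw [Equiv.apply_symm_apply]
      omega
    refine ⟨?_, ?_, hj⟩
    · by_contra h
      exact hnot (apply_lt_apply_of_forall_lt_succ hi fun m h1 _ => hk m (by omega))
    · by_contra h
      exact hnot (apply_lt_apply_of_forall_lt_succ hi fun m _ h2 => hk m (by omega))
  · rintro ⟨hi, hj, hij⟩
    have hi0 : i ≠ 0 := by
      rintro rfl
      have := hπ 0 (Or.inl rfl)
      omega
    have hj0 : j ≠ 0 := by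
      rintro rfl
      have := hsymm 0 (Or.inl rfl)
      omega
    have hin : i ≤ n := by
      by_contra h
      have h1 := hπ i (by omega)
      have h2 := hπ (π.symm j) (by omega)
      rw [Equiv.apply_symm_apply] at h2
      omega
    have hjn : j ≤ n := by
      by_contra h
      have h1 := hsymm (π i) (by omega)
      rw [Equiv.symm_apply_apply] at h1
      omega
    exact ⟨by simp only; omega, hin, by simp only; omega, hjn, hij, by simp only; omega⟩

theorem reflTransGen_of_forall_succ {α : Type*} {r : α → α → Prop} [Std.Symm r]
    {f : ℕ → α} {s t a b : ℕ} (h : ∀ m, s ≤ m → m < t → r (f m) (f (m + 1)))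
    (ha : s ≤ a ∧ a ≤ t) (hb : s ≤ b ∧ b ≤ t) : Relation.ReflTransGen r (f a) (f b) := by
  have key : ∀ m, s ≤ m → m ≤ t → Relation.ReflTransGen r (f s) (f m) := by
    intro m hm
    induction m, hm using Nat.le_induction with
    | base => exact fun _ => .refl
    | succ m hm ih => exact fun hmt => (ih (by omega)).tail (h m hm (by omega))
  exact (Std.Symm.symm _ _ (key a ha.1 ha.2)).trans (key b hb.1 hb.2)

/-- Any two cells of a rectangle contained in the Rothe diagram are connected. -/
theorem reflTransGen_rotheAdj_of_rectangle {n : ℕ} {π : Equiv.Perm ℕ} {r₁ r₂ c₁ c₂ : ℕ}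
    (h : ∀ i j, r₁ ≤ i → i ≤ r₂ → c₁ ≤ j → j ≤ c₂ → (i, j) ∈ RotheDiagram n π)
    {a b a' b' : ℕ} (ha : r₁ ≤ a ∧ a ≤ r₂) (hb : c₁ ≤ b ∧ b ≤ c₂)
    (ha' : r₁ ≤ a' ∧ a' ≤ r₂) (hb' : c₁ ≤ b' ∧ b' ≤ c₂) :
    Relation.ReflTransGen (RotheAdj n π) (a, b) (a', b') := by
  have : Std.Symm (RotheAdj n π) := ⟨fun _ _ => RotheAdj.symm⟩
  have hrow : Relation.ReflTransGen (RotheAdj n π) (a, b) (a, b') :=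
    reflTransGen_of_forall_succ (f := fun j => (a, j))
      (fun m h1 h2 => ⟨h _ _ ha.1 ha.2 h1 h2.le, h _ _ ha.1 ha.2 (by omega) h2,
        Or.inl ⟨rfl, Or.inl rfl⟩⟩) hb hb'
  have hcol : Relation.ReflTransGen (RotheAdj n π) (a, b') (a', b') :=
    reflTransGen_of_forall_succ (f := fun i => (i, b'))
      (fun m h1 h2 => ⟨h _ _ h1 h2.le hb'.1 hb'.2, h _ _ (by omega) h2 hb'.1 hb'.2,
        Or.inr ⟨rfl, Or.inl rfl⟩⟩) ha ha'
  exact hrow.trans hcol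

/-- The maximal interval of a set of natural numbers around one of its elements. -/
theorem exists_maximal_interval {J : ℕ → Prop} {x y : ℕ} (hx : J x) (hxy : x < y)
    (hy : ¬ J y) :
    ∃ c₁ c₂, c₁ ≤ x ∧ x ≤ c₂ ∧ (∀ j, c₁ ≤ j → j ≤ c₂ → J j) ∧
      (∀ j, j + 1 = c₁ → ¬ J j) ∧ ¬ J (c₂ + 1) := by
  classical
  have hlow : ∃ c, c ≤ x ∧ ∀ j, c ≤ j → j ≤ x → J j :=
    ⟨x, le_rfl, fun j h1 h2 => le_antisymm h1 h2 ▸ hx⟩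
  have hupp : ∃ c, x ≤ c ∧ ¬ J (c + 1) :=
    ⟨y - 1, by omega, by rwa [Nat.sub_add_cancel (by omega)]⟩
  obtain ⟨h1, h2⟩ := Nat.find_spec hlow
  obtain ⟨h3, h4⟩ := Nat.find_spec hupp
  refine ⟨Nat.find hlow, Nat.find hupp, h1, h3, fun j hj1 hj2 => ?_, fun j hj hJ => ?_, h4⟩
  · by_cases hjx : j ≤ x
    · exact h2 j hj1 hjx
    · have := Nat.find_min hupp (m := j - 1) (by omega)
      rw [Nat.sub_add_cancel (by omega)] at this
      by_contra hJ
      exact this ⟨by omega, hJ⟩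
  · refine Nat.find_min hlow (m := j) (by omega) ⟨by omega, fun m hm1 hm2 => ?_⟩
    rcases hm1.eq_or_lt with rfl | hlt
    · exact hJ
    · exact h2 m (by omega) hm2

/-- If `π` is Grassmannian (at most one descent), every connected component of
its Rothe diagram is a rectangle. -/
theorem component_rectangle_of_grassmannian (n : ℕ) (π : Equiv.Perm ℕ)
    (hπ : ∀ m : ℕ, m = 0 ∨ n < m → π m = m)
    (hG : IsGrassmannian n π)
    (B : Set (ℕ × ℕ)) (hB : IsRotheComponent n π B) :
    ∃ r₁ r₂ c₁ c₂ : ℕ, r₁ ≤ r₂ ∧ c₁ ≤ c₂ ∧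
      B = {p : ℕ × ℕ | r₁ ≤ p.1 ∧ p.1 ≤ r₂ ∧ c₁ ≤ p.2 ∧ p.2 ≤ c₂} := by
  obtain ⟨⟨i₀, j₀⟩, hp, rfl⟩ := hB
  obtain ⟨k, hk⟩ := hG.exists_forall_lt_succ hπ
  have hD := mem_rotheDiagram_iff hπ hk
  obtain ⟨hi₀, hj₀, hij₀⟩ := (hD i₀ j₀).mp hp
  obtain ⟨c₁, c₂, hc₁, hc₂, hJ, hJ₁, hJ₂⟩ :=
    exists_maximal_interval (J := fun j => k < π.symm j) hj₀ hij₀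
      (by rw [Equiv.symm_apply_apply]; omega)
  -- No value `π i` with `i ≤ k` lies in the interval `[c₁, c₂]`.
  have hrow : ∀ i, i ≤ k → ∀ j, c₁ ≤ j → j ≤ c₂ → (j < π i ↔ j₀ < π i) := by
    intro i hi j hj1 hj2
    have hout : ¬ (c₁ ≤ π i ∧ π i ≤ c₂) := fun h => by
      have := hJ (π i) h.1 h.2
      rw [Equiv.symm_apply_apply] at this
      omega
    omega
  have hex : ∃ i, j₀ < π i := ⟨i₀, hij₀⟩
  have hr := Nat.find_spec hex
  have hr_le : ∀ i, j₀ < π i → Nat.find hex ≤ i := fun i hi => Nat.find_min' hex hi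
  have hrows : ∀ i, i ≤ k → (j₀ < π i ↔ Nat.find hex ≤ i) := by
    refine fun i hi => ⟨hr_le i, fun h => ?_⟩
    rcases h.eq_or_lt with h | h
    · rwa [← h]
    · exact hr.trans (apply_lt_apply_of_forall_lt_succ h fun m _ hm => hk m (by omega))
  generalize Nat.find hex = r at hrows
  have hrect : ∀ i j, r ≤ i → i ≤ k → c₁ ≤ j → j ≤ c₂ → (i, j) ∈ RotheDiagram n π :=
    fun i j h1 h2 h3 h4 =>
      (hD i j).mpr ⟨h2, hJ j h3 h4, (hrow i h2 j h3 h4).mpr ((hrows i h2).mpr h1)⟩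
  have hr₀ : r ≤ i₀ := (hrows i₀ hi₀).mp hij₀
  refine ⟨r, k, c₁, c₂, hr₀.trans hi₀, hc₁.trans hc₂, Set.ext fun q => ⟨fun hq => ?_, ?_⟩⟩
  · induction hq with
    | refl => exact ⟨hr₀, hi₀, hc₁, hc₂⟩
    | @tail a b _ hab ih =>
      obtain ⟨x, y⟩ := a
      obtain ⟨x', y'⟩ := b
      obtain ⟨-, hb, hadj⟩ := hab
      obtain ⟨hx', hy', hxy'⟩ := (hD x' y').mp hb
      obtain ⟨-, -, h3, h4⟩ := ih
      dsimp only at h3 h4 hadj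
      have hcol : c₁ ≤ y' ∧ y' ≤ c₂ := by
        by_contra hout
        have hcases : y' + 1 = c₁ ∨ y' = c₂ + 1 := by omega
        rcases hcases with h | rfl
        · exact hJ₁ y' h hy'
        · exact hJ₂ hy'
      exact ⟨(hrows x' hx').mp ((hrow x' hx' y' hcol.1 hcol.2).mp hxy'), hx', hcol⟩
  · rintro ⟨h1, h2, h3, h4⟩
    exact reflTransGen_rotheAdj_of_rectangle hrect ⟨hr₀, hi₀⟩ ⟨hc₁, hc₂⟩ ⟨h1, h2⟩ ⟨h3, h4⟩
end

section
/- Let π be a Grassmannian permutation of {1,…,n} (a permutation with at most one descent), and let B₁ and B₂ be two consecutive connected components (rectangular blocks) of the Rothe diagram D(π), say B₁ = {(i,j) : r₁ ≤ i ≤ m, c₁ ≤ j ≤ j₁} and B₂ = {(i,j) : r₂ ≤ i ≤ m, c₂ ≤ j ≤ j₂} with common bottom row m and j₁ < c₂, such that no cell of D(π) lies in a column strictly between j₁ and c₂. Then the height of B₁ exceeds the height of B₂ by the horizontal distance between the blocks: (m − r₁ + 1) = (m − r₂ + 1) + (c₂ − j₁ − 1). -/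
lemma IsRotheComponent.subset_rotheDiagram {n : ℕ} {π : Equiv.Perm ℕ} {B : Set (ℕ × ℕ)}
    (hB : IsRotheComponent n π B) : B ⊆ RotheDiagram n π := by
  obtain ⟨p, hp, rfl⟩ := hB
  intro q hq
  rcases Relation.ReflTransGen.cases_tail hq with h | ⟨c, -, hc⟩
  · exact h ▸ hp
  · exact hc.2.1

lemma IsRotheComponent.mem_of_rotheAdj {n : ℕ} {π : Equiv.Perm ℕ} {B : Set (ℕ × ℕ)}
    (hB : IsRotheComponent n π B) {q q' : ℕ × ℕ} (hq : q ∈ B) (h : RotheAdj n π q q') :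
    q' ∈ B := by
  obtain ⟨p, hp, rfl⟩ := hB
  exact Relation.ReflTransGen.tail hq h

/-- The row just above a rectangular component has no cell in the columns of the component, so
its value under `π` does not exceed those columns. -/
lemma IsRotheComponent.apply_top_sub_one_le {n : ℕ} {π : Equiv.Perm ℕ} (h0 : π 0 = 0)
    {B : Set (ℕ × ℕ)} (hB : IsRotheComponent n π B) {r j : ℕ} (hmem : (r, j) ∈ B)
    (hnot : (r - 1, j) ∉ B) : π (r - 1) ≤ j := by
  have hD := hB.subset_rotheDiagram hmem
  obtain ⟨h1, h2, h3, h4, h5, h6⟩ := hD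
  simp only at h1 h2 h3 h4 h5 h6
  by_contra! hlt
  have hr : r - 1 ≠ 0 := fun h => by rw [h, h0] at hlt; omega
  refine hnot (hB.mem_of_rotheAdj hmem ⟨hB.subset_rotheDiagram hmem, ?_, Or.inr ⟨rfl, ?_⟩⟩)
  · exact ⟨by simp only; omega, by simp only; omega, h3, h4, hlt, by simp only; omega⟩
  · simp only; omega

/-- The bottom row of a rectangular component is a descent of `π`. -/
lemma IsRotheComponent.apply_bottom_succ_lt {n : ℕ} {π : Equiv.Perm ℕ}
    (hπ : ∀ k : ℕ, k = 0 ∨ n < k → π k = k)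
    {B : Set (ℕ × ℕ)} (hB : IsRotheComponent n π B) {m j : ℕ} (hmem : (m, j) ∈ B)
    (hnot : (m + 1, j) ∉ B) : π (m + 1) < π m := by
  have hD := hB.subset_rotheDiagram hmem
  obtain ⟨h1, h2, h3, h4, h5, h6⟩ := hD
  simp only at h1 h2 h3 h4 h5 h6
  by_contra! hle
  have hmn : m + 1 ≤ n := by
    by_contra! hlt
    have hs := hπ (π.symm j) (Or.inr (by omega))
    rw [Equiv.apply_symm_apply] at hs
    omega
  have hne : π.symm j ≠ m + 1 := fun h => by
    rw [← h, Equiv.apply_symm_apply] at hle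
    omega
  refine hnot (hB.mem_of_rotheAdj hmem ⟨hB.subset_rotheDiagram hmem, ?_, Or.inr ⟨rfl, Or.inl rfl⟩⟩)
  exact ⟨by simp only; omega, hmn, h3, h4, by simp only; omega, by simp only; omega⟩

/-- A Grassmannian permutation is increasing up to its descent. -/
lemma IsGrassmannian.strictMonoOn_Iic {n : ℕ} {π : Equiv.Perm ℕ} (h0 : π 0 = 0)
    (hG : IsGrassmannian n π) {m : ℕ} (hm : m ∈ Finset.Icc 1 n) (hdesc : π (m + 1) < π m) :
    StrictMonoOn π (Set.Iic m) := by
  have step : ∀ i < m, π i < π (i + 1) := by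
    intro i hi
    by_contra! hle
    have hlt : π (i + 1) < π i := lt_of_le_of_ne hle (fun h => by simpa using π.injective h)
    have hi0 : i ≠ 0 := fun h => by rw [h, h0] at hlt; omega
    rw [Finset.mem_Icc] at hm
    have := Finset.card_le_one.mp hG i
      (Finset.mem_filter.mpr ⟨Finset.mem_Icc.mpr (by omega), hlt⟩) m
      (Finset.mem_filter.mpr ⟨Finset.mem_Icc.mpr hm, hdesc⟩)
    omega
  intro a _ b hb hab
  induction b, hab using Nat.le_induction with
  | base => exact step a hb
  | succ k hk ih => exact (ih (le_trans (Nat.le_succ k) hb)).trans (step k hb)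

/-- If `π` is Grassmannian and `B₁ = [r₁,m] × [c₁,j₁]`, `B₂ = [r₂,m] × [c₂,j₂]`
are two consecutive rectangular connected components of `D(π)` (with common
bottom row `m`, `j₁ < c₂`, and no cell of `D(π)` in a column strictly between
`j₁` and `c₂`), then the height of `B₁` exceeds the height of `B₂` by the
horizontal distance between the blocks:
`m - r₁ + 1 = (m - r₂ + 1) + (c₂ - j₁ - 1)`. -/
theorem consecutive_blocks_height_of_grassmannian (n : ℕ) (π : Equiv.Perm ℕ)
    (hπ : ∀ m' : ℕ, m' = 0 ∨ n < m' → π m' = m')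
    (hG : IsGrassmannian n π)
    (B₁ B₂ : Set (ℕ × ℕ))
    (hB₁ : IsRotheComponent n π B₁) (hB₂ : IsRotheComponent n π B₂)
    (r₁ r₂ m c₁ j₁ c₂ j₂ : ℕ)
    (hr₁ : r₁ ≤ m) (hc₁ : c₁ ≤ j₁) (hr₂ : r₂ ≤ m) (hc₂ : c₂ ≤ j₂)
    (hB₁eq : B₁ = {p : ℕ × ℕ | r₁ ≤ p.1 ∧ p.1 ≤ m ∧ c₁ ≤ p.2 ∧ p.2 ≤ j₁})
    (hB₂eq : B₂ = {p : ℕ × ℕ | r₂ ≤ p.1 ∧ p.1 ≤ m ∧ c₂ ≤ p.2 ∧ p.2 ≤ j₂})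
    (hlt : j₁ < c₂)
    (hgap : ∀ p ∈ RotheDiagram n π, ¬ (j₁ < p.2 ∧ p.2 < c₂)) :
    m - r₁ + 1 = (m - r₂ + 1) + (c₂ - j₁ - 1) := by
  have h0 : π 0 = 0 := hπ 0 (Or.inl rfl)
  have mem₁ : ∀ i j, (i, j) ∈ B₁ ↔ r₁ ≤ i ∧ i ≤ m ∧ c₁ ≤ j ∧ j ≤ j₁ := fun i j => by
    rw [hB₁eq]; rfl
  have mem₂ : ∀ i j, (i, j) ∈ B₂ ↔ r₂ ≤ i ∧ i ≤ m ∧ c₂ ≤ j ∧ j ≤ j₂ := fun i j => by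
    rw [hB₂eq]; rfl
  have hbot₁ : (m, j₁) ∈ B₁ := (mem₁ _ _).2 (by omega)
  have htop₁ : (r₁, j₁) ∈ B₁ := (mem₁ _ _).2 (by omega)
  have hbot₂ : (m, c₂) ∈ B₂ := (mem₂ _ _).2 (by omega)
  have htop₂ : (r₂, c₂) ∈ B₂ := (mem₂ _ _).2 (by omega)
  obtain ⟨hm1, hmn, -, -, -, hj₁⟩ := hB₁.subset_rotheDiagram hbot₁
  obtain ⟨-, -, -, hc₂n, hc₂m, hc₂s⟩ := hB₂.subset_rotheDiagram hbot₂
  obtain ⟨hr₁1, -, -, -, hr₁j, -⟩ := hB₁.subset_rotheDiagram htop₁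
  obtain ⟨hr₂1, -, -, -, hr₂c, -⟩ := hB₂.subset_rotheDiagram htop₂
  simp only at hm1 hmn hj₁ hc₂n hc₂m hc₂s hr₁1 hr₁j hr₂1 hr₂c
  have hmono : StrictMonoOn π (Set.Iic m) := hG.strictMonoOn_Iic h0
    (Finset.mem_Icc.mpr ⟨hm1, hmn⟩)
    (hB₁.apply_bottom_succ_lt hπ hbot₁ (fun h => by have := (mem₁ _ _).1 h; omega))
  have hup₁ : π (r₁ - 1) ≤ j₁ := hB₁.apply_top_sub_one_le h0 htop₁
    (fun h => by have := (mem₁ _ _).1 h; omega)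
  have hup₂ : π (r₂ - 1) ≤ c₂ := hB₂.apply_top_sub_one_le h0 htop₂
    (fun h => by have := (mem₂ _ _).1 h; omega)
  have hle : ∀ {a b}, a ≤ m → b ≤ m → a ≤ b → π a ≤ π b := fun ha hb hab =>
    hmono.monotoneOn ha hb hab
  have hr : r₁ ≤ r₂ := by
    by_contra! hlt'
    have := hle (a := r₂) (b := r₁ - 1) (by omega) (by omega) (by omega)
    omega
  have himage : (Finset.Ico r₁ r₂).image π = Finset.Ioo j₁ c₂ := by
    ext j
    simp only [Finset.mem_image, Finset.mem_Ico, Finset.mem_Ioo]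
    constructor
    · rintro ⟨i, ⟨hi₁, hi₂⟩, rfl⟩
      have ha := hle (a := r₁) (b := i) (by omega) (by omega) hi₁
      have hb := hle (a := i) (b := r₂ - 1) (by omega) (by omega) (by omega)
      have hne : π i ≠ c₂ := fun h => by
        rw [← h, Equiv.symm_apply_apply] at hc₂s
        omega
      omega
    · rintro ⟨hj, hj'⟩
      have hs : π (π.symm j) = j := π.apply_symm_apply j
      have him : π.symm j ≤ m := by
        by_contra! hlt'
        exact hgap (m, j) ⟨hm1, hmn, by simp only; omega, by simp only; omega,
          by simp only; omega, hlt'⟩ ⟨hj, hj'⟩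
      refine ⟨π.symm j, ⟨?_, ?_⟩, hs⟩
      · by_contra! hlt'
        have := hle (a := π.symm j) (b := r₁ - 1) him (by omega) (by omega)
        omega
      · by_contra! hlt'
        have := hle (a := r₂) (b := π.symm j) hr₂ him hlt'
        omega
  have hcard := congrArg Finset.card himage
  rw [Finset.card_image_of_injective _ π.injective, Nat.card_Ico, Nat.card_Ioo] at hcard
  omega
end
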